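/- Let n ≥ 3. There is a (well-defined) surjective K-algebra homomorphism φ : ATL_n → TL(B_n) determined by φ(U_i) = U_i for 1 ≤ i ≤ n−1, φ(D) = (1 − qU_{n−1})(1 − qU_{n−2})⋯(1 − qU_1)·s_0, and φ(D^{−1}) = s_0·(1 − q^{−1}U_1)(1 − q^{−1}U_2)⋯(1 − q^{−1}U_{n−1}). -/

import Mathlib

noncomputable section

/-- The ground field `K = ℂ(q)`, the complex rational functions. -/
abbrev K : Type := RatFunc ℂ

/-- The variable `q ∈ K = ℂ(q)`. -/
noncomputable def q : K := RatFunc.X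

/-- `δ = q + q⁻¹ ∈ K`. -/
noncomputable def δ : K := q + q⁻¹

/-- Defining relations of the type `B` Temperley–Lieb algebra `TL(Bₙ)` (over `K`, with
`δ = q + q⁻¹`): the generator of index `0` is `s₀` and the generator of index `i`
(for `1 ≤ i ≤ n-1`) is `Uᵢ`.  The relations are `Uᵢ² = δUᵢ`, `UᵢU_{i+1}Uᵢ = Uᵢ`,
`U_{i+1}UᵢU_{i+1} = U_{i+1}`, `UᵢUⱼ = UⱼUᵢ` for `|i-j| ≥ 2`, `s₀² = 1`, `U₁s₀U₁ = 0` and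
`s₀Uᵢ = Uᵢs₀` for `i ≥ 2`. -/
inductive TLBRel (n : ℕ) : FreeAlgebra K (Fin n) → FreeAlgebra K (Fin n) → Prop
  | Usq (i : Fin n) (hi : 1 ≤ (i : ℕ)) :
      TLBRel n (FreeAlgebra.ι K i * FreeAlgebra.ι K i) (δ • FreeAlgebra.ι K i)
  | braid₁ (i j : Fin n) (hi : 1 ≤ (i : ℕ)) (hj : (j : ℕ) = (i : ℕ) + 1) :
      TLBRel n (FreeAlgebra.ι K i * FreeAlgebra.ι K j * FreeAlgebra.ι K i) (FreeAlgebra.ι K i)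
  | braid₂ (i j : Fin n) (hi : 1 ≤ (i : ℕ)) (hj : (j : ℕ) = (i : ℕ) + 1) :
      TLBRel n (FreeAlgebra.ι K j * FreeAlgebra.ι K i * FreeAlgebra.ι K j) (FreeAlgebra.ι K j)
  | Ucomm (i j : Fin n) (hi : 1 ≤ (i : ℕ)) (h : (i : ℕ) + 2 ≤ (j : ℕ)) :
      TLBRel n (FreeAlgebra.ι K i * FreeAlgebra.ι K j) (FreeAlgebra.ι K j * FreeAlgebra.ι K i)
  | s0sq (i : Fin n) (hi : (i : ℕ) = 0) : TLBRel n (FreeAlgebra.ι K i * FreeAlgebra.ι K i) 1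
  | UsU (i j : Fin n) (hi : (i : ℕ) = 0) (hj : (j : ℕ) = 1) :
      TLBRel n (FreeAlgebra.ι K j * FreeAlgebra.ι K i * FreeAlgebra.ι K j) 0
  | s0comm (i j : Fin n) (hi : (i : ℕ) = 0) (h : 2 ≤ (j : ℕ)) :
      TLBRel n (FreeAlgebra.ι K i * FreeAlgebra.ι K j) (FreeAlgebra.ι K j * FreeAlgebra.ι K i)

/-- The type `B` Temperley–Lieb algebra `TL(Bₙ)` over `K = ℂ(q)` with `δ = q + q⁻¹`. -/
abbrev TLB (n : ℕ) := RingQuot (TLBRel n)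

/-- The generator of `TL(Bₙ)` with index `i`: `g n 0 = s₀`, and `g n i = Uᵢ` for
`1 ≤ i ≤ n-1` (indices out of range are sent to `0`). -/
noncomputable def g (n : ℕ) (i : ℕ) : TLB n :=
  if h : i < n then RingQuot.mkAlgHom K (TLBRel n) (FreeAlgebra.ι K ⟨i, h⟩) else 0

/-- `IsJW n ε b` says that `b` is a type `B` Jones–Wenzl projector of sign `ε` in `TL(Bₙ)`:
`b` is a nonzero idempotent with `s₀·b = ε·b = b·s₀` and `Uᵢ·b = 0 = b·Uᵢ` for all
`1 ≤ i ≤ n-1`.  For `ε = 1` this characterizes `b_{n,+}` and for `ε = -1` it characterizes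
`b_{n,-}`. -/
def IsJW (n : ℕ) (ε : K) (b : TLB n) : Prop :=
  b ≠ 0 ∧ b * b = b ∧ g n 0 * b = ε • b ∧ b * g n 0 = ε • b ∧
    ∀ i : ℕ, 1 ≤ i → i ≤ n - 1 → g n i * b = 0 ∧ b * g n i = 0

/-- The generator of `ATLₙ` of index `k` in the free algebra on `Fin (n-1) ⊕ Bool`
(the generator `inl ⟨k⟩` is `U_{k+1}` for `0 ≤ k ≤ n-2`; out-of-range indices give `0`). -/
noncomputable def atlGen (n : ℕ) (k : ℕ) : FreeAlgebra K (Fin (n - 1) ⊕ Bool) :=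
  if h : k < n - 1 then FreeAlgebra.ι K (Sum.inl ⟨k, h⟩) else 0

/-- The generator `D` of `ATLₙ` in the free algebra. -/
noncomputable def atlD (n : ℕ) : FreeAlgebra K (Fin (n - 1) ⊕ Bool) :=
  FreeAlgebra.ι K (Sum.inr false)

/-- The generator `D⁻¹` of `ATLₙ` in the free algebra. -/
noncomputable def atlDinv (n : ℕ) : FreeAlgebra K (Fin (n - 1) ⊕ Bool) :=
  FreeAlgebra.ι K (Sum.inr true)

/-- For `m : ℕ`, `atlU n m` is the element `U_{m mod n}` of the free algebra, where `Uᵢ` for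
`1 ≤ i ≤ n-1` is the generator `inl (i-1)` and `U₀ = Uₙ := D·U₁·D⁻¹`. -/
noncomputable def atlU (n : ℕ) (m : ℕ) : FreeAlgebra K (Fin (n - 1) ⊕ Bool) :=
  if m % n = 0 then atlD n * atlGen n 0 * atlDinv n else atlGen n (m % n - 1)

/-- Defining relations of the extended affine Temperley–Lieb algebra `ATLₙ` (`δ = q + q⁻¹`):
with indices read mod `n` and `U₀ := Uₙ := DU₁D⁻¹`, the relations are `Uᵢ² = δUᵢ`,
`UᵢU_{i+1}Uᵢ = Uᵢ` and `U_{i+1}UᵢU_{i+1} = U_{i+1}` for all `i ∈ ℤ/n`, `UᵢUⱼ = UⱼUᵢ`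
whenever `i - j ≠ ±1` in `ℤ/n`, `DD⁻¹ = 1 = D⁻¹D`, and `UᵢD = DU_{i+1}` for all `i ∈ ℤ/n`. -/
inductive ATLRel (n : ℕ) :
    FreeAlgebra K (Fin (n - 1) ⊕ Bool) → FreeAlgebra K (Fin (n - 1) ⊕ Bool) → Prop
  | Usq (i : ℕ) (h : i < n) : ATLRel n (atlU n i * atlU n i) (δ • atlU n i)
  | braid₁ (i : ℕ) (h : i < n) :
      ATLRel n (atlU n i * atlU n (i + 1) * atlU n i) (atlU n i)
  | braid₂ (i : ℕ) (h : i < n) :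
      ATLRel n (atlU n (i + 1) * atlU n i * atlU n (i + 1)) (atlU n (i + 1))
  | comm (i j : ℕ) (hi : i < n) (hj : j < n) (h₁ : (i + 1) % n ≠ j) (h₂ : (j + 1) % n ≠ i) :
      ATLRel n (atlU n i * atlU n j) (atlU n j * atlU n i)
  | DDinv : ATLRel n (atlD n * atlDinv n) 1
  | DinvD : ATLRel n (atlDinv n * atlD n) 1
  | slide (i : ℕ) (h : i < n) : ATLRel n (atlU n i * atlD n) (atlD n * atlU n (i + 1))

/-- The extended affine Temperley–Lieb algebra `ATLₙ` over `K` (`δ = q + q⁻¹`). -/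
abbrev ATL (n : ℕ) := RingQuot (ATLRel n)

/-- The element `U_{m mod n}` of `ATLₙ`. -/
noncomputable def aU (n : ℕ) (m : ℕ) : ATL n :=
  RingQuot.mkAlgHom K (ATLRel n) (atlU n m)

/-- The generator `D` of `ATLₙ`. -/
noncomputable def aD (n : ℕ) : ATL n := RingQuot.mkAlgHom K (ATLRel n) (atlD n)

/-- The generator `D⁻¹` of `ATLₙ`. -/
noncomputable def aDinv (n : ℕ) : ATL n := RingQuot.mkAlgHom K (ATLRel n) (atlDinv n)

/-! ### Relations among the generators of `TL(Bₙ)` -/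

theorem g_of_lt {n i : ℕ} (h : i < n) :
    g n i = RingQuot.mkAlgHom K (TLBRel n) (FreeAlgebra.ι K ⟨i, h⟩) := by
  simp [g, h]

theorem g_mul_self {n i : ℕ} (hi : 1 ≤ i) (h : i < n) : g n i * g n i = δ • g n i := by
  rw [g_of_lt h, ← map_mul, ← map_smul]
  exact RingQuot.mkAlgHom_rel K (TLBRel.Usq ⟨i, h⟩ hi)

theorem g_mul_succ_mul {n i : ℕ} (hi : 1 ≤ i) (h : i + 1 < n) :
    g n i * g n (i + 1) * g n i = g n i := by
  rw [g_of_lt h, g_of_lt (Nat.lt_of_succ_lt h), ← map_mul, ← map_mul]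
  exact RingQuot.mkAlgHom_rel K (TLBRel.braid₁ ⟨i, _⟩ ⟨i + 1, h⟩ hi rfl)

theorem g_succ_mul_mul {n i : ℕ} (hi : 1 ≤ i) (h : i + 1 < n) :
    g n (i + 1) * g n i * g n (i + 1) = g n (i + 1) := by
  rw [g_of_lt h, g_of_lt (Nat.lt_of_succ_lt h), ← map_mul, ← map_mul]
  exact RingQuot.mkAlgHom_rel K (TLBRel.braid₂ ⟨i, _⟩ ⟨i + 1, h⟩ hi rfl)

theorem commute_g {n i j : ℕ} (hi : 1 ≤ i) (hij : i + 2 ≤ j) (h : j < n) :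
    Commute (g n i) (g n j) := by
  rw [Commute, SemiconjBy, g_of_lt h, g_of_lt (by omega : i < n), ← map_mul, ← map_mul]
  exact RingQuot.mkAlgHom_rel K (TLBRel.Ucomm ⟨i, _⟩ ⟨j, h⟩ hi hij)

theorem g_zero_mul_self {n : ℕ} (h : 0 < n) : g n 0 * g n 0 = 1 := by
  rw [g_of_lt h, ← map_mul, ← map_one (RingQuot.mkAlgHom K (TLBRel n))]
  exact RingQuot.mkAlgHom_rel K (TLBRel.s0sq ⟨0, h⟩ rfl)

theorem g_one_mul_zero_mul_one {n : ℕ} (h : 1 < n) : g n 1 * g n 0 * g n 1 = 0 := by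
  rw [g_of_lt h, g_of_lt (Nat.zero_lt_of_lt h), ← map_mul, ← map_mul,
    ← map_zero (RingQuot.mkAlgHom K (TLBRel n))]
  exact RingQuot.mkAlgHom_rel K (TLBRel.UsU ⟨0, _⟩ ⟨1, h⟩ rfl rfl)

theorem commute_g_zero {n j : ℕ} (hj : 2 ≤ j) (h : j < n) : Commute (g n 0) (g n j) := by
  rw [Commute, SemiconjBy, g_of_lt h, g_of_lt (by omega : 0 < n), ← map_mul, ← map_mul]
  exact RingQuot.mkAlgHom_rel K (TLBRel.s0comm ⟨0, _⟩ ⟨j, h⟩ rfl hj)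

theorem q_ne_zero : q ≠ 0 := RatFunc.X_ne_zero

/-! ### Braid-like elements `1 - a U` -/

section Braid

variable {k A : Type*} [CommRing k] [Ring A] [Algebra k A] {a b : k} {u v x : A}

theorem Commute.one_sub_smul_right (h : Commute x u) (c : k) : Commute x (1 - c • u) :=
  (Commute.one_right x).sub_right (h.smul_right c)

theorem one_sub_smul_mul_one_sub_smul (hab : a * b = 1) (hu : u * u = (a + b) • u) :
    (1 - a • u) * (1 - b • u) = 1 := by
  simp only [mul_sub, sub_mul, mul_one, one_mul, smul_mul_assoc, mul_smul_comm, hu]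
  linear_combination (norm := module) ((a + b) * hab) • u

/-- `U_i T_{i+1} T_i = T_{i+1} T_i U_{i+1}` for `T = 1 - aU`; the roles of `i` and `i + 1` may be
exchanged. -/
theorem mul_one_sub_smul_mul_one_sub_smul (hab : a * b = 1)
    (hu : u * u = (a + b) • u) (hv : v * v = (a + b) • v)
    (huv : u * v * u = u) (hvu : v * u * v = v) :
    u * ((1 - a • v) * (1 - a • u)) = (1 - a • v) * (1 - a • u) * v := by
  simp only [mul_sub, sub_mul, mul_one, one_mul, smul_mul_assoc, mul_smul_comm, ← mul_assoc,
    hu, hv, huv, hvu]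
  linear_combination (norm := module) hab • (v - u)

end Braid

/-- The descending product `f (m - 1) * ⋯ * f 1 * f 0`. -/
def descProd {A : Type*} [Monoid A] (f : ℕ → A) : ℕ → A
  | 0 => 1
  | m + 1 => f m * descProd f m

theorem descProd_succ' {A : Type*} [Monoid A] (f : ℕ → A) (m : ℕ) :
    descProd f (m + 1) = descProd (fun k => f (k + 1)) m * f 0 := by
  induction m with
  | zero => simp [descProd]
  | succ m ih => rw [descProd, ih, descProd, mul_assoc]

theorem prod_map_range_sub {A : Type*} [Monoid A] (f : ℕ → A) (m : ℕ) :
    ((List.range m).map fun k => f (m - k)).prod = descProd (fun k => f (k + 1)) m := by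
  induction m with
  | zero => simp [descProd]
  | succ m ih =>
    rw [List.prod_range_succ', descProd, ← ih]
    simp

theorem commute_descProd {A : Type*} [Monoid A] {f : ℕ → A} {x : A} {m : ℕ}
    (h : ∀ k < m, Commute x (f k)) : Commute x (descProd f m) := by
  induction m with
  | zero => exact Commute.one_right x
  | succ m ih => exact (h m m.lt_succ_self).mul_right (ih fun k hk => h k (by omega))

theorem descProd_mul_prod_range {A : Type*} [Monoid A] {f f' : ℕ → A} {m : ℕ}
    (h : ∀ k < m, f k * f' k = 1) : descProd f m * ((List.range m).map f').prod = 1 := by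
  induction m generalizing f f' with
  | zero => simp [descProd]
  | succ m ih =>
    rw [List.prod_range_succ', descProd_succ', mul_assoc, ← mul_assoc (f 0), h 0 m.succ_pos,
      one_mul]
    exact ih fun k hk => h (k + 1) (by omega)

theorem prod_range_mul_descProd {A : Type*} [Monoid A] {f f' : ℕ → A} {m : ℕ}
    (h : ∀ k < m, f' k * f k = 1) : ((List.range m).map f').prod * descProd f m = 1 := by
  induction m with
  | zero => simp [descProd]
  | succ m ih =>
    rw [List.prod_range_succ, descProd, mul_assoc, ← mul_assoc (f' m), h m m.lt_succ_self,
      one_mul]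
    exact ih fun k hk => h k (by omega)

/-! ### The images of `D` and `D⁻¹` -/

/-- The invertible element `T_i = 1 - q U_i` of `TL(Bₙ)`. -/
def braidT (n i : ℕ) : TLB n := 1 - q • g n i

/-- The image `T_{n-1} ⋯ T_1 s₀` of `D` in `TL(Bₙ)`. -/
def imD (n : ℕ) : TLB n := descProd (fun k => braidT n (k + 1)) (n - 1) * g n 0

/-- The image of `D⁻¹` in `TL(Bₙ)`. -/
def imDinv (n : ℕ) : TLB n :=
  g n 0 * ((List.range (n - 1)).map (fun k => 1 - q⁻¹ • g n (k + 1))).prod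

theorem braidT_mul_inv {n i : ℕ} (hi : 1 ≤ i) (h : i < n) :
    braidT n i * (1 - q⁻¹ • g n i) = 1 :=
  one_sub_smul_mul_one_sub_smul (mul_inv_cancel₀ q_ne_zero) (g_mul_self hi h)

theorem inv_mul_braidT {n i : ℕ} (hi : 1 ≤ i) (h : i < n) :
    (1 - q⁻¹ • g n i) * braidT n i = 1 :=
  one_sub_smul_mul_one_sub_smul (inv_mul_cancel₀ q_ne_zero)
    ((g_mul_self hi h).trans (by rw [δ, add_comm]))

theorem commute_braidT {n i : ℕ} {x : TLB n} (h : Commute x (g n i)) :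
    Commute x (braidT n i) :=
  h.one_sub_smul_right q

theorem imD_mul_imDinv {n : ℕ} (hn : 0 < n) : imD n * imDinv n = 1 := by
  rw [imD, imDinv, mul_assoc, ← mul_assoc (g n 0), g_zero_mul_self hn, one_mul]
  exact descProd_mul_prod_range fun k hk => braidT_mul_inv (by omega) (by omega)

theorem prod_mul_imD (n : ℕ) :
    ((List.range (n - 1)).map (fun k => 1 - q⁻¹ • g n (k + 1))).prod * imD n = g n 0 := by
  rw [imD, ← mul_assoc, prod_range_mul_descProd, one_mul]
  exact fun k hk => inv_mul_braidT (by omega) (by omega)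

theorem imDinv_mul_imD {n : ℕ} (hn : 0 < n) : imDinv n * imD n = 1 := by
  rw [imDinv, mul_assoc, prod_mul_imD, g_zero_mul_self hn]

theorem g_mul_descProd {n i m : ℕ} (hi : 1 ≤ i) (him : i + 1 ≤ m) (hm : m < n) :
    g n i * descProd (fun k => braidT n (k + 1)) m =
      descProd (fun k => braidT n (k + 1)) m * g n (i + 1) := by
  induction m with
  | zero => omega
  | succ m ih =>
    rcases (by omega : i + 1 ≤ m ∨ i = m) with h | rfl
    · have hc : Commute (g n i) (braidT n (m + 1)) :=
        (commute_g hi (by omega) hm).one_sub_smul_right q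
      rw [descProd, ← mul_assoc, hc.eq, mul_assoc, ih h (by omega), mul_assoc]
    · obtain ⟨j, rfl⟩ : ∃ j, i = j + 1 := ⟨i - 1, by omega⟩
      have hc : Commute (g n (j + 1 + 1)) (descProd (fun k => braidT n (k + 1)) j) :=
        commute_descProd fun k hk =>
          (commute_g (by omega) (by omega) hm).symm.one_sub_smul_right q
      have hs := mul_one_sub_smul_mul_one_sub_smul (mul_inv_cancel₀ q_ne_zero)
        (g_mul_self hi (by omega)) (g_mul_self (by omega) hm)
        (g_mul_succ_mul hi hm) (g_succ_mul_mul hi hm)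
      rw [descProd, descProd, ← mul_assoc (braidT n _), mul_assoc _ _ (g n _), ← hc.eq,
        ← mul_assoc (g n _), ← mul_assoc _ (g n _)]
      exact congrArg (· * _) hs

theorem g_mul_imD {n i : ℕ} (hi : 1 ≤ i) (h : i + 1 < n) :
    g n i * imD n = imD n * g n (i + 1) := by
  rw [imD, ← mul_assoc, g_mul_descProd hi (by omega) (by omega), mul_assoc, mul_assoc,
    (commute_g_zero (by omega) h).eq]

theorem g_mul_descProd_mul_descProd {n m : ℕ} (hm : m + 1 < n) :
    g n (m + 1) *
        (descProd (fun k => braidT n (k + 1)) (m + 1) * descProd (fun k => braidT n (k + 2)) m) =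
      descProd (fun k => braidT n (k + 1)) (m + 1) * descProd (fun k => braidT n (k + 2)) m *
        g n 1 := by
  induction m with
  | zero =>
    simpa [descProd] using (commute_braidT (Commute.refl (g n 1))).eq
  | succ m ih =>
    specialize ih (by omega)
    set P := descProd (fun k => braidT n (k + 1)) m
    set Q := descProd (fun k => braidT n (k + 2)) m
    have hu := g_mul_self (i := m + 1) (by omega) (by omega : m + 1 < n)
    have hv := g_mul_self (i := m + 1 + 1) (by omega) hm
    have huv := g_mul_succ_mul (i := m + 1) (by omega) hm
    have hvu := g_succ_mul_mul (i := m + 1) (by omega) hm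
    have hPT : Commute P (braidT n (m + 1 + 1)) :=
      ((commute_descProd fun k hk =>
        (commute_g (by omega) (by omega) hm).symm.one_sub_smul_right q).symm).one_sub_smul_right q
    have hslide : g n (m + 1 + 1) * (braidT n (m + 1) * braidT n (m + 1 + 1)) =
        braidT n (m + 1) * braidT n (m + 1 + 1) * g n (m + 1) :=
      mul_one_sub_smul_mul_one_sub_smul (mul_inv_cancel₀ q_ne_zero) hv hu hvu huv
    have hvT : Commute (g n (m + 1 + 1)) (braidT n (m + 1 + 1)) :=
      (Commute.refl _).one_sub_smul_right q
    have huT : Commute (g n (m + 1)) (braidT n (m + 1)) :=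
      (Commute.refl _).one_sub_smul_right q
    have hPQ : g n (m + 1) * (P * Q) = P * Q * g n 1 := by
      have hunit : IsUnit (braidT n (m + 1)) :=
        ⟨⟨_, _, braidT_mul_inv (by omega) (by omega), inv_mul_braidT (by omega) (by omega)⟩, rfl⟩
      apply hunit.mul_left_cancel
      rw [← mul_assoc, ← huT.eq]
      simpa only [descProd, mul_assoc] using ih
    have hfactor : descProd (fun k => braidT n (k + 1)) (m + 1 + 1) *
          descProd (fun k => braidT n (k + 2)) (m + 1) =
        braidT n (m + 1 + 1) * (braidT n (m + 1) * braidT n (m + 1 + 1)) * (P * Q) := by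
      calc _ = braidT n (m + 1 + 1) * (braidT n (m + 1) * P) * (braidT n (m + 1 + 1) * Q) := rfl
        _ = braidT n (m + 1 + 1) * braidT n (m + 1) * (P * braidT n (m + 1 + 1)) * Q := by
          simp only [mul_assoc]
        _ = _ := by rw [hPT.eq]; simp only [mul_assoc]
    set T := braidT n (m + 1 + 1)
    rw [hfactor]
    calc _ = g n (m + 1 + 1) * T * (braidT n (m + 1) * T) * (P * Q) := by simp only [mul_assoc]
      _ = T * (g n (m + 1 + 1) * (braidT n (m + 1) * T)) * (P * Q) := by
        rw [hvT.eq]; simp only [mul_assoc]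
      _ = T * (braidT n (m + 1) * T) * (g n (m + 1) * (P * Q)) := by
        rw [hslide]; simp only [mul_assoc]
      _ = _ := by rw [hPQ, ← mul_assoc]

theorem g_mul_imD_mul_imD {n : ℕ} (hn : 2 ≤ n) :
    g n (n - 1) * (imD n * imD n) = imD n * imD n * g n 1 := by
  obtain ⟨m, rfl⟩ : ∃ m, n = m + 2 := ⟨n - 2, by omega⟩
  have hs0 := g_zero_mul_self (n := m + 2) (by omega)
  have hUsU := g_one_mul_zero_mul_one (n := m + 2) (by omega)
  set s := g (m + 2) 0
  set u := g (m + 2) 1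
  set P := descProd (fun k => braidT (m + 2) (k + 1)) (m + 1)
  set Q := descProd (fun k => braidT (m + 2) (k + 2)) m
  have hP : P = Q * (1 - q • u) := descProd_succ' _ m
  have hsQ : Commute s Q := commute_descProd fun k hk =>
    (commute_g_zero (by omega) (by omega)).one_sub_smul_right q
  have hD : imD (m + 2) * imD (m + 2) = P * Q * (s * (1 - q • u) * s) := by
    calc _ = P * s * (P * s) := rfl
      _ = P * (s * Q) * (1 - q • u) * s := by
        conv_lhs => rw [hP]
        conv_rhs => rw [hP]
        simp only [mul_assoc]
      _ = _ := by rw [hsQ.eq]; simp only [mul_assoc]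
  have hu : u * (s * (1 - q • u) * s) = s * (1 - q • u) * s * u := by
    have h : s * (u * (s * u)) = 0 := by rw [← mul_assoc u, hUsU, mul_zero]
    simp only [mul_sub, sub_mul, mul_one, one_mul, smul_mul_assoc, mul_smul_comm, hs0,
      ← mul_assoc, hUsU, zero_mul, smul_zero, sub_zero]
    simp only [mul_assoc, h, smul_zero, sub_zero]
  have hPQ : g (m + 2) (m + 1) * (P * Q) = P * Q * u := g_mul_descProd_mul_descProd (by omega)
  rw [hD, show m + 2 - 1 = m + 1 from rfl, ← mul_assoc, hPQ, mul_assoc, hu,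
    ← mul_assoc]

/-! ### The homomorphism -/

/-- The map from the free algebra inducing `ATLₙ → TL(Bₙ)`. -/
def freeHom (n : ℕ) : FreeAlgebra K (Fin (n - 1) ⊕ Bool) →ₐ[K] TLB n :=
  FreeAlgebra.lift K
    (Sum.elim (fun k => g n (k + 1)) fun b => if b then imDinv n else imD n)

theorem freeHom_atlD (n : ℕ) : freeHom n (atlD n) = imD n := by
  simp [freeHom, atlD]

theorem freeHom_atlDinv (n : ℕ) : freeHom n (atlDinv n) = imDinv n := by
  simp [freeHom, atlDinv]

theorem freeHom_atlGen {n k : ℕ} (h : k < n - 1) : freeHom n (atlGen n k) = g n (k + 1) := by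
  simp [freeHom, atlGen, h]

theorem freeHom_atlU {n i : ℕ} (hi : 1 ≤ i) (h : i < n) : freeHom n (atlU n i) = g n i := by
  rw [atlU, Nat.mod_eq_of_lt h, if_neg (by omega), freeHom_atlGen (by omega),
    Nat.sub_add_cancel hi]

theorem freeHom_atlU_zero {n : ℕ} (hn : 2 ≤ n) :
    freeHom n (atlU n 0) = imD n * g n 1 * imDinv n := by
  rw [atlU, if_pos (Nat.zero_mod n), map_mul, map_mul, freeHom_atlD, freeHom_atlDinv,
    freeHom_atlGen (by omega)]

theorem atlU_mod (n m : ℕ) : atlU n (m % n) = atlU n m := by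
  simp [atlU]

theorem atlU_self (n : ℕ) : atlU n n = atlU n 0 := by
  simp [atlU]

theorem freeHom_slide {n i : ℕ} (hn : 2 ≤ n) (h : i < n) :
    freeHom n (atlU n i) * imD n = imD n * freeHom n (atlU n (i + 1)) := by
  rcases (by omega : i = 0 ∨ (1 ≤ i ∧ i + 1 < n) ∨ i + 1 = n) with rfl | ⟨h₁, h₂⟩ | h₁
  · rw [freeHom_atlU_zero hn, zero_add, freeHom_atlU le_rfl (by omega), mul_assoc,
      imDinv_mul_imD (by omega), mul_one]
  · rw [freeHom_atlU h₁ h, freeHom_atlU (by omega) h₂, g_mul_imD h₁ h₂]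
  · obtain rfl : i = n - 1 := by omega
    rw [h₁, atlU_self, freeHom_atlU_zero hn, freeHom_atlU (by omega) h, ← mul_assoc,
      ← mul_assoc, ← g_mul_imD_mul_imD hn, mul_assoc, mul_assoc, imD_mul_imDinv (by omega),
      mul_one]

/-- Conjugation by the image of `D` lowers the index of `U_i`. -/
theorem freeHom_atlU_eq_conj {n : ℕ} (hn : 2 ≤ n) (i : ℕ) :
    freeHom n (atlU n i) = imD n * freeHom n (atlU n (i + 1)) * imDinv n := by
  have hmod : atlU n (i % n + 1) = atlU n (i + 1) := by
    rw [← atlU_mod n (i % n + 1), Nat.mod_add_mod, atlU_mod]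
  rw [← hmod, ← freeHom_slide hn (Nat.mod_lt i (by omega)), mul_assoc,
    imD_mul_imDinv (by omega), mul_one, atlU_mod]

theorem conj_mul_conj {n : ℕ} (hn : 0 < n) (x y : TLB n) :
    imD n * x * imDinv n * (imD n * y * imDinv n) = imD n * (x * y) * imDinv n := by
  calc _ = imD n * x * (imDinv n * imD n) * y * imDinv n := by simp only [mul_assoc]
    _ = _ := by rw [imDinv_mul_imD hn, mul_one]; simp only [mul_assoc]

theorem freeHom_Usq {n i : ℕ} (hn : 2 ≤ n) (h : i < n) :
    freeHom n (atlU n i) * freeHom n (atlU n i) = δ • freeHom n (atlU n i) := by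
  rcases Nat.eq_zero_or_pos i with rfl | hi
  · rw [freeHom_atlU_zero hn, conj_mul_conj (by omega), g_mul_self le_rfl (by omega),
      mul_smul_comm, smul_mul_assoc]
  · rw [freeHom_atlU hi h, g_mul_self hi h]

theorem freeHom_braid_of_succ {n i j : ℕ} (hn : 2 ≤ n)
    (h : freeHom n (atlU n (i + 1)) * freeHom n (atlU n (j + 1)) * freeHom n (atlU n (i + 1)) =
      freeHom n (atlU n (i + 1))) :
    freeHom n (atlU n i) * freeHom n (atlU n j) * freeHom n (atlU n i) =
      freeHom n (atlU n i) := by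
  rw [freeHom_atlU_eq_conj hn i, freeHom_atlU_eq_conj hn j, conj_mul_conj (by omega),
    conj_mul_conj (by omega), h]

theorem freeHom_braid {n i : ℕ} (hn : 3 ≤ n) (h : i < n) :
    freeHom n (atlU n i) * freeHom n (atlU n (i + 1)) * freeHom n (atlU n i) =
        freeHom n (atlU n i) ∧
      freeHom n (atlU n (i + 1)) * freeHom n (atlU n i) * freeHom n (atlU n (i + 1)) =
        freeHom n (atlU n (i + 1)) := by
  have hgen : ∀ j, 1 ≤ j → j + 1 < n →
      freeHom n (atlU n j) * freeHom n (atlU n (j + 1)) * freeHom n (atlU n j) =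
          freeHom n (atlU n j) ∧
        freeHom n (atlU n (j + 1)) * freeHom n (atlU n j) * freeHom n (atlU n (j + 1)) =
          freeHom n (atlU n (j + 1)) := fun j hj hjn => by
    rw [freeHom_atlU hj (by omega), freeHom_atlU (by omega) hjn]
    exact ⟨g_mul_succ_mul hj hjn, g_succ_mul_mul hj hjn⟩
  have hzero := (hgen 1 le_rfl (by omega)).imp (freeHom_braid_of_succ (i := 0) (by omega))
    (freeHom_braid_of_succ (j := 0) (by omega))
  rcases (by omega : i = 0 ∨ (1 ≤ i ∧ i + 1 < n) ∨ i + 1 = n) with rfl | ⟨h₁, h₂⟩ | h₁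
  · exact hzero
  · exact hgen i h₁ h₂
  · have hn0 : atlU n (i + 1) = atlU n 0 := by rw [h₁, atlU_self]
    have hn1 : atlU n (i + 1 + 1) = atlU n (0 + 1) := by
      rw [h₁, ← atlU_mod, Nat.add_mod_left, atlU_mod]
    rw [← hn0, ← hn1] at hzero
    exact hzero.imp (freeHom_braid_of_succ (by omega)) (freeHom_braid_of_succ (by omega))

theorem freeHom_commute {n i j : ℕ} (hn : 3 ≤ n) (hij : i < j) (hj : j < n) (h₁ : i + 1 ≠ j)
    (h₂ : (j + 1) % n ≠ i) : Commute (freeHom n (atlU n i)) (freeHom n (atlU n j)) := by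
  rcases Nat.eq_zero_or_pos i with rfl | hi
  · have hjn : j + 1 < n := by
      refine lt_of_le_of_ne hj fun h => h₂ ?_
      rw [h, Nat.mod_self]
    rw [Commute, SemiconjBy, freeHom_atlU_eq_conj (by omega) 0,
      freeHom_atlU_eq_conj (by omega) j, conj_mul_conj (by omega), conj_mul_conj (by omega),
      freeHom_atlU (by omega) (by omega), freeHom_atlU (by omega) hjn,
      (commute_g (by omega) (by omega) hjn).eq]
  · rw [freeHom_atlU hi (by omega), freeHom_atlU (by omega) hj]
    exact commute_g hi (by omega) hj

theorem freeHom_rel {n : ℕ} (hn : 3 ≤ n) ⦃x y : FreeAlgebra K (Fin (n - 1) ⊕ Bool)⦄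
    (h : ATLRel n x y) : freeHom n x = freeHom n y := by
  cases h with
  | Usq i h => rw [map_mul, map_smul, freeHom_Usq (by omega) h]
  | braid₁ i h => rw [map_mul, map_mul, (freeHom_braid hn h).1]
  | braid₂ i h => rw [map_mul, map_mul, (freeHom_braid hn h).2]
  | comm i j hi hj h₁ h₂ =>
    rw [map_mul, map_mul]
    rcases lt_trichotomy i j with h | rfl | h
    · rw [Nat.mod_eq_of_lt (by omega)] at h₁
      exact (freeHom_commute hn h hj h₁ h₂).eq
    · rfl
    · rw [Nat.mod_eq_of_lt (by omega)] at h₂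
      exact (freeHom_commute hn h hi h₂ h₁).symm.eq
  | DDinv => rw [map_mul, map_one, freeHom_atlD, freeHom_atlDinv, imD_mul_imDinv (by omega)]
  | DinvD => rw [map_mul, map_one, freeHom_atlD, freeHom_atlDinv, imDinv_mul_imD (by omega)]
  | slide i h => rw [map_mul, map_mul, freeHom_atlD, freeHom_slide (by omega) h]

theorem adjoin_range_g (n : ℕ) : Algebra.adjoin K (Set.range fun i : Fin n => g n i) = ⊤ := by
  have hg : (fun i : Fin n => g n i) = RingQuot.mkAlgHom K (TLBRel n) ∘ FreeAlgebra.ι K :=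
    funext fun i => g_of_lt i.isLt
  rw [hg, Set.range_comp, ← AlgHom.map_adjoin, FreeAlgebra.adjoin_range_ι, Algebra.map_top,
    AlgHom.range_eq_top]
  exact RingQuot.mkAlgHom_surjective K (TLBRel n)

/-- For `n ≥ 3` there is a surjective `K`-algebra homomorphism
`φ : ATLₙ → TL(Bₙ)` with `φ(Uᵢ) = Uᵢ` for `1 ≤ i ≤ n-1`,
`φ(D) = (1 - qU_{n-1})(1 - qU_{n-2})⋯(1 - qU₁)·s₀` and
`φ(D⁻¹) = s₀·(1 - q⁻¹U₁)(1 - q⁻¹U₂)⋯(1 - q⁻¹U_{n-1})`. -/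
theorem stmt_18 (n : ℕ) (hn : 3 ≤ n) :
    ∃ φ : ATL n →ₐ[K] TLB n,
      Function.Surjective φ ∧
      (∀ i : ℕ, 1 ≤ i → i ≤ n - 1 → φ (aU n i) = g n i) ∧
      φ (aD n) =
        ((List.range (n - 1)).map (fun k => 1 - q • g n (n - 1 - k))).prod * g n 0 ∧
      φ (aDinv n) =
        g n 0 * ((List.range (n - 1)).map (fun k => 1 - q⁻¹ • g n (k + 1))).prod := by
  let φ : ATL n →ₐ[K] TLB n := RingQuot.liftAlgHom K ⟨freeHom n, freeHom_rel hn⟩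
  have hφ : ∀ x, φ (RingQuot.mkAlgHom K (ATLRel n) x) = freeHom n x :=
    RingQuot.liftAlgHom_mkAlgHom_apply K (freeHom n) (freeHom_rel hn)
  have hU : ∀ i : ℕ, 1 ≤ i → i ≤ n - 1 → φ (aU n i) = g n i := fun i hi h =>
    (hφ _).trans (freeHom_atlU hi (by omega))
  have hD : φ (aD n) = imD n := (hφ _).trans (freeHom_atlD n)
  refine ⟨φ, ?_, hU, ?_, (hφ _).trans (freeHom_atlDinv n)⟩
  · rw [← AlgHom.range_eq_top, eq_top_iff, ← adjoin_range_g, Algebra.adjoin_le_iff]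
    have hmem : ∀ i, 1 ≤ i → i < n → g n i ∈ φ.range := fun i hi h => ⟨_, hU i hi (by omega)⟩
    rintro _ ⟨i, rfl⟩
    rcases Nat.eq_zero_or_pos (i : ℕ) with hi | hi
    · simp only [hi]
      rw [← prod_mul_imD]
      refine mul_mem (list_prod_mem fun x hx => ?_) ⟨_, hD⟩
      obtain ⟨k, hk, rfl⟩ := List.mem_map.mp hx
      rw [List.mem_range] at hk
      exact sub_mem (one_mem _) (Subalgebra.smul_mem _ (hmem _ (by omega) (by omega)) _)
    · exact hmem i hi i.isLt
  · rw [hD, imD, ← prod_map_range_sub]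
    rfl
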